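/- arXiv:1912.00620 — 3 statements merged into one kernel-verified Lean document; each statement's English description precedes it below -/
import Mathlib

section
/- Let (A1, A2) be an r×n matrix pair over a field K with column set E and let w : E → ℕ be a weight function. For every x ∈ ℕ, the coefficient of θ^x in the polynomial det(A1 · D(θ^w) · A2ᵀ) ∈ K[θ] equals Σ_{B ∈ B_x} det A1[B] · det A2[B], where B_x = {B ∈ B(A1,A2) : w(B) = x} and w(B) = Σ_{j∈B} w(j). In particular, if (A1, A2) is a Pfaffian pair with constant c, this coefficient equals c · (|B_x| : K). -/
open Matrix Polynomial

/-- The square submatrix of `A` formed by the columns in `B` taken in increasing order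
(junk value `0` if `B.card ≠ r`). -/
noncomputable def colSub {R : Type*} [CommRing R] {r : ℕ} {E : Type*} [Fintype E] [LinearOrder E]
    (A : Matrix (Fin r) E R) (B : Finset E) : Matrix (Fin r) (Fin r) R :=
  if h : B.card = r then A.submatrix id (fun i => B.orderEmbOfFin h i) else 0

/-- The set of common bases of the matrix pair `(A1, A2)`. -/
noncomputable def commonBases {K : Type*} [Field K] {r : ℕ} {E : Type*} [Fintype E]
    [LinearOrder E] (A1 A2 : Matrix (Fin r) E K) : Finset (Finset E) := by
  classical
  exact Finset.univ.filter
    (fun B => B.card = r ∧ (colSub A1 B).det ≠ 0 ∧ (colSub A2 B).det ≠ 0)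

theorem cb_expand {R : Type*} [CommRing R] {r : ℕ} {E : Type*} [Fintype E] [LinearOrder E]
    (M N : Matrix (Fin r) E R) :
    (M * Nᵀ).det = ∑ f : Fin r → E, (∏ i, N i (f i)) * (M.submatrix id f).det := by
  simp only [Matrix.det_apply', Matrix.mul_apply, Finset.prod_univ_sum, Finset.mul_sum,
    Fintype.piFinset_univ]
  rw [Finset.sum_comm]
  refine Finset.sum_congr rfl fun f _ => Finset.sum_congr rfl fun σ _ => ?_
  simp only [Finset.prod_mul_distrib, Matrix.transpose_apply, Matrix.submatrix_apply, id]
  ring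

theorem cb_fiber {R : Type*} [CommRing R] {r : ℕ} {E : Type*} [Fintype E] [LinearOrder E]
    (M N : Matrix (Fin r) E R) (B : Finset E) (h : B.card = r) :
    ∑ f : Fin r → E with Finset.univ.image f = B, (∏ i, N i (f i)) * (M.submatrix id f).det
      = (colSub M B).det * (colSub N B).det := by
  have key : ∑ τ : Equiv.Perm (Fin r),
      (∏ i, N i (B.orderEmbOfFin h (τ i))) *
        (M.submatrix id (fun i => B.orderEmbOfFin h (τ i))).det
      = (colSub M B).det * (colSub N B).det := by
    rw [← Matrix.det_transpose (colSub N B), Matrix.det_apply' (colSub N B)ᵀ, Finset.mul_sum]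
    refine Finset.sum_congr rfl fun τ _ => ?_
    have := Matrix.det_permute' τ (colSub M B)
    simp only [colSub, dif_pos h, Matrix.submatrix_submatrix] at this ⊢
    have e : M.submatrix id (fun i => B.orderEmbOfFin h (τ i)) =
      M.submatrix (id ∘ id) ((fun i => B.orderEmbOfFin h i) ∘ τ) := rfl
    rw [e, this]
    simp only [Matrix.transpose_apply, Matrix.submatrix_apply, id]
    ring
  rw [← key]
  symm
  refine Finset.sum_bij (fun τ _ => fun i => B.orderEmbOfFin h (τ i)) ?_ ?_ ?_ ?_
  · intro τ _
    simp only [Finset.mem_filter, Finset.mem_univ, true_and]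
    apply Finset.eq_of_subset_of_card_le
    · intro e he
      obtain ⟨i, _, rfl⟩ := Finset.mem_image.1 he
      exact Finset.orderEmbOfFin_mem B h _
    · rw [Finset.card_image_of_injective _
        (fun a b hab => τ.injective ((B.orderEmbOfFin h).injective hab)), h]
      simp
  · intro τ _ τ' _ hh
    ext i
    exact congrArg Fin.val ((B.orderEmbOfFin h).injective (congrFun hh i))
  · intro f hf
    simp only [Finset.mem_filter, Finset.mem_univ, true_and] at hf
    have hinj : Function.Injective f := by
      have : (Finset.univ.image f).card = (Finset.univ : Finset (Fin r)).card := by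
        rw [hf, h]; simp
      have := Finset.card_image_iff.1 this
      intro a b hab
      exact this (by simp) (by simp) hab
    have hm : ∀ i, f i ∈ B := fun i => by rw [← hf]; simp
    have hex : ∀ i, ∃ k, B.orderEmbOfFin h k = f i := fun i => by
      have : f i ∈ Set.range (B.orderEmbOfFin h) := by
        rw [Finset.range_orderEmbOfFin]; exact hm i
      exact this
    choose g hg using hex
    have gi : Function.Injective g := fun a b hab => hinj (by rw [← hg, ← hg, hab])
    exact ⟨Equiv.ofBijective g (Finite.injective_iff_bijective.1 gi), Finset.mem_univ _,
      funext fun i => hg i⟩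
  · intro τ _
    rfl

theorem cb_main {R : Type*} [CommRing R] {r : ℕ} {E : Type*} [Fintype E] [LinearOrder E]
    (M N : Matrix (Fin r) E R) :
    (M * Nᵀ).det = ∑ B : Finset E with B.card = r, (colSub M B).det * (colSub N B).det := by
  rw [cb_expand, ← Finset.sum_fiberwise Finset.univ (fun f : Fin r → E => Finset.univ.image f),
    Finset.sum_filter]
  refine Finset.sum_congr rfl fun B _ => ?_
  split_ifs with h
  · exact cb_fiber M N B h
  · refine Finset.sum_eq_zero fun f hf => ?_
    simp only [Finset.mem_filter, Finset.mem_univ, true_and] at hf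
    have hni : ¬ Function.Injective f := fun hi => h (by
      rw [← hf, Finset.card_image_of_injective _ hi]; simp)
    simp only [Function.Injective, not_forall] at hni
    obtain ⟨a, b, hab, hne⟩ := hni
    rw [Matrix.det_zero_of_column_eq hne (fun k => by simp [hab]), mul_zero]

theorem det_colSub_map {K : Type*} [Field K] {r : ℕ} {E : Type*} [Fintype E]
    [LinearOrder E] (A : Matrix (Fin r) E K) (B : Finset E) (h : B.card = r) :
    (colSub (A.map Polynomial.C) B).det = Polynomial.C (colSub A B).det := by
  rw [RingHom.map_det]
  simp only [colSub, dif_pos h]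
  rfl

theorem det_colSub_diag {R : Type*} [CommRing R] {r : ℕ} {E : Type*} [Fintype E]
    [LinearOrder E] (A : Matrix (Fin r) E R) (d : E → R) (B : Finset E) (h : B.card = r) :
    (colSub (A * Matrix.diagonal d) B).det = (∏ j ∈ B, d j) * (colSub A B).det := by
  have hp : ∏ j ∈ B, d j = ∏ i : Fin r, d (B.orderEmbOfFin h i) := by
    have hB : B = Finset.univ.map (B.orderEmbOfFin h).toEmbedding :=
      (Finset.map_orderEmbOfFin_univ B h).symm
    conv_lhs => rw [hB]
    rw [Finset.prod_map]
    rfl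
  rw [hp, ← Matrix.det_mul_row]
  simp only [colSub, dif_pos h]
  congr 1
  ext i j
  simp [Matrix.mul_diagonal, mul_comm]

theorem coeff_main {K : Type*} [Field K] {r : ℕ} {E : Type*} [Fintype E]
    [LinearOrder E] (A1 A2 : Matrix (Fin r) E K) (w : E → ℕ) (x : ℕ) :
    ((A1.map Polynomial.C *
        Matrix.diagonal (fun j => (Polynomial.X : Polynomial K) ^ w j) *
        (A2.map Polynomial.C)ᵀ).det).coeff x
      = ∑ B ∈ (commonBases A1 A2).filter (fun B => ∑ j ∈ B, w j = x),
          (colSub A1 B).det * (colSub A2 B).det := by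
  classical
  rw [cb_main, Polynomial.finsetSum_coeff]
  simp only [commonBases, Finset.sum_filter]
  refine Finset.sum_congr rfl fun B _ => ?_
  by_cases h : B.card = r
  · rw [if_pos h, det_colSub_diag _ _ _ h, det_colSub_map _ _ h, det_colSub_map _ _ h,
      Finset.prod_pow_eq_pow_sum, mul_assoc, ← Polynomial.C_mul, mul_comm,
      Polynomial.coeff_C_mul_X_pow]
    by_cases h1 : (colSub A1 B).det = 0
    · simp [h1]
    by_cases h2 : (colSub A2 B).det = 0
    · simp [h2]
    simp [h, h1, h2, eq_comm]
  · simp [h]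

/-- For a weighted matrix pair `(A1, A2)` with weight `w : E → ℕ`, the coefficient of `θ^x` in
`det (A1 * D(θ^w) * A2ᵀ) ∈ K[θ]` equals `∑_{B ∈ B_x} det A1[B] * det A2[B]`, where
`B_x` is the set of common bases of weight `x`.  In particular, if `(A1, A2)` is Pfaffian with
constant `c`, this coefficient equals `c * |B_x|` in `K`. -/
theorem weighted_pair_coeff {K : Type*} [Field K] {r : ℕ} {E : Type*} [Fintype E]
    [LinearOrder E] (A1 A2 : Matrix (Fin r) E K) (w : E → ℕ) (x : ℕ) :
    ((A1.map Polynomial.C *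
        Matrix.diagonal (fun j => (Polynomial.X : Polynomial K) ^ w j) *
        (A2.map Polynomial.C)ᵀ).det).coeff x
      = ∑ B ∈ (commonBases A1 A2).filter (fun B => ∑ j ∈ B, w j = x),
          (colSub A1 B).det * (colSub A2 B).det
    ∧ ∀ c : K, c ≠ 0 →
        (∀ B ∈ commonBases A1 A2, (colSub A1 B).det * (colSub A2 B).det = c) →
        ((A1.map Polynomial.C *
            Matrix.diagonal (fun j => (Polynomial.X : Polynomial K) ^ w j) *
            (A2.map Polynomial.C)ᵀ).det).coeff x
          = c * (((commonBases A1 A2).filter (fun B => ∑ j ∈ B, w j = x)).card : K) := by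
  refine ⟨coeff_main A1 A2 w x, fun c _ hc => ?_⟩
  rw [coeff_main, Finset.sum_congr rfl
    (fun B hB => hc B (Finset.mem_filter.1 hB).1), Finset.sum_const, nsmul_eq_mul, mul_comm]
end

section
/- Let K be a field, ι a finite type with |ι| = r, E a linearly ordered finite set, A : Matrix ι E K, and b : ι → E injective with A(i, b(i')) = [i = i'] for all i, i' ∈ ι. Let w : E → ℝ and suppose B = b(ι) is a minimum-weight base of A with respect to w. Define A# : Matrix ι E K by A#(i, j) = A(i, j) if w(b(i)) = w(j) and A#(i, j) = 0 otherwise. Then for every S ⊆ E with |S| = r: (i) A#[S] is nonsingular if and only if A[S] is nonsingular and w(S) = w(B) (i.e., S is a minimum-weight base of A); and (ii) if A#[S] is nonsingular, then det A#[S] = det A[S]. -/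
open Matrix

/-- The square submatrix of `A` formed by the columns in `B` taken in increasing order,
matched against the rows of `A` taken in increasing order (junk value `0` if
`B.card ≠ |ι|`). -/
noncomputable def colSubE {K : Type*} [CommRing K] {ι F : Type*} [Fintype ι] [LinearOrder ι]
    [Fintype F] [LinearOrder F] (A : Matrix ι F K) (B : Finset F) : Matrix ι ι K :=
  if h : B.card = Fintype.card ι then
    A.submatrix id (fun i =>
      B.orderEmbOfFin h ((Finset.univ.orderIsoOfFin Finset.card_univ).symm ⟨i, Finset.mem_univ i⟩))
  else 0

/-- The matrix `A#` obtained from `A` by keeping the entry `A i j` when `w (b i) = w j` and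
replacing it by `0` otherwise. -/
noncomputable def sharp {K : Type*} [CommRing K] {ι E : Type*} (A : Matrix ι E K)
    (b : ι → E) (w : E → ℝ) : Matrix ι E K :=
  Matrix.of fun i j => if w (b i) = w j then A i j else 0

/-- column selector -/
theorem colSubE_exists {ι E : Type*} [Fintype ι] [LinearOrder ι]
    [Fintype E] [LinearOrder E] (S : Finset E) (hS : S.card = Fintype.card ι) :
    ∃ e : ι → E, Function.Injective e ∧ Finset.univ.image e = S ∧
      ∀ {K : Type _} [CommRing K] (A : Matrix ι E K), colSubE A S = A.submatrix id e := by
  have hinj : Function.Injective (fun i : ι =>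
      S.orderEmbOfFin hS ((Finset.univ.orderIsoOfFin Finset.card_univ).symm
        ⟨i, Finset.mem_univ i⟩)) := by
    intro x y hxy
    simpa using hxy
  refine ⟨_, hinj, ?_, ?_⟩
  · apply Finset.eq_of_subset_of_card_le
    · intro x hx
      obtain ⟨i, -, rfl⟩ := Finset.mem_image.1 hx
      exact Finset.orderEmbOfFin_mem _ _ _
    · rw [Finset.card_image_of_injective _ hinj, hS, Finset.card_univ]
  · intro K _ A
    rw [colSubE, dif_pos hS]

theorem colSubE_ne {K : Type*} [Field K] {ι E : Type*} [Fintype ι] [LinearOrder ι]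
    [Fintype E] [LinearOrder E] (A : Matrix ι E K) (c : ι → E) (hc : Function.Injective c)
    (h : (A.submatrix id c).det ≠ 0) :
    (colSubE A (Finset.univ.image c)).det ≠ 0 := by
  obtain ⟨e, he, hS, hA⟩ := colSubE_exists (ι := ι) (Finset.univ.image c)
    (by rw [Finset.card_image_of_injective _ hc, Finset.card_univ])
  have : ∀ i, ∃ k, e k = c i := by
    intro i
    have : c i ∈ Finset.univ.image e := by rw [hS]; simp
    simpa using this
  choose σ hσ using this
  have hσi : Function.Injective σ := by
    intro x y hxy
    apply hc
    rw [← hσ, ← hσ, hxy]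
  let τ : Equiv.Perm ι := Equiv.ofBijective σ (Finite.injective_iff_bijective.1 hσi)
  have h2 : A.submatrix id c = (A.submatrix id e).submatrix id τ := by
    ext i k
    simp [τ, hσ]
  rw [h2, Matrix.det_permute'] at h
  rw [hA]
  exact right_ne_zero_of_mul h

/-- If the columns of `A` indexed by `B = b(ι)` form an identity matrix and `B` is a
minimum-weight base of `A` with respect to `w`, then for every `S ⊆ E` with `|S| = r`:
(i) `A#[S]` is nonsingular iff `S` is a minimum-weight base of `A`; and
(ii) if `A#[S]` is nonsingular then `det A#[S] = det A[S]`. -/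
theorem sharp_bases {K : Type*} [Field K] {ι E : Type*} [Fintype ι] [LinearOrder ι]
    [Fintype E] [LinearOrder E] (A : Matrix ι E K) (b : ι → E)
    (hb : Function.Injective b)
    (hA : ∀ i i' : ι, A i (b i') = if i = i' then 1 else 0)
    (w : E → ℝ)
    (hBbase : (colSubE A (Finset.univ.image b)).det ≠ 0)
    (hBmin : ∀ S : Finset E, S.card = Fintype.card ι → (colSubE A S).det ≠ 0 →
      ∑ j ∈ Finset.univ.image b, w j ≤ ∑ j ∈ S, w j) :
    ∀ S : Finset E, S.card = Fintype.card ι →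
      ((colSubE (sharp A b w) S).det ≠ 0 ↔
        ((colSubE A S).det ≠ 0 ∧ ∑ j ∈ S, w j = ∑ j ∈ Finset.univ.image b, w j))
      ∧ ((colSubE (sharp A b w) S).det ≠ 0 →
          (colSubE (sharp A b w) S).det = (colSubE A S).det) := by
  have key : ∀ i j, A i j ≠ 0 → w (b i) ≤ w j := by
    intro i j hij
    by_cases hj : ∃ i', b i' = j
    · obtain ⟨i', rfl⟩ := hj
      rw [hA] at hij
      have : i = i' := by by_contra h; simp [h] at hij
      rw [this]
    · push Not at hj
      have hc : Function.Injective (Function.update b i j) := by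
        intro x y hxy
        by_cases hx : x = i <;> by_cases hy : y = i
        · rw [hx, hy]
        · subst hx
          simp [hy] at hxy
          exact absurd hxy.symm (hj y)
        · subst hy
          simp [hx] at hxy
          exact absurd hxy (hj x)
        · simp [hx, hy] at hxy
          exact hb hxy
      have hm : A.submatrix id (Function.update b i j) =
          (1 : Matrix ι ι K).updateCol i (fun k => A k j) := by
        ext x y
        by_cases hy : y = i
        · subst hy; simp
        · simp [hy, hA, Matrix.one_apply]
      have hd : (A.submatrix id (Function.update b i j)).det ≠ 0 := by
        rw [hm, ← Matrix.cramer_apply, Matrix.cramer_one]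
        simpa using hij
      have := hBmin _ (by rw [Finset.card_image_of_injective _ hc, Finset.card_univ])
        (colSubE_ne A _ hc hd)
      rw [Finset.sum_image hb.injOn, Finset.sum_image hc.injOn,
        ← Finset.add_sum_erase _ _ (Finset.mem_univ i),
        ← Finset.add_sum_erase (a := i) _ (fun x => w (Function.update b i j x))
          (Finset.mem_univ i)] at this
      have h3 : ∑ x ∈ Finset.univ.erase i, w (Function.update b i j x)
          = ∑ x ∈ Finset.univ.erase i, w (b x) := by
        apply Finset.sum_congr rfl
        intro x hx
        rw [Function.update_of_ne (Finset.ne_of_mem_erase hx)]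
      rw [h3] at this
      rw [Function.update_self] at this
      linarith
  intro S hS
  obtain ⟨e, he, hSe, hE⟩ := colSubE_exists (ι := ι) S hS
  have hwS : ∑ j ∈ S, w j = ∑ k, w (e k) := by
    rw [← hSe, Finset.sum_image he.injOn]
  have hwB : ∑ j ∈ Finset.univ.image b, w j = ∑ k, w (b k) := Finset.sum_image hb.injOn
  rw [hE, hE, hwS, hwB]
  by_cases hw : ∑ k, w (e k) = ∑ k, w (b k)
  · have : ((sharp A b w).submatrix id e).det = (A.submatrix id e).det := by
      rw [Matrix.det_apply, Matrix.det_apply]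
      refine Finset.sum_congr rfl fun σ _ => ?_
      congr 1
      by_cases hz : ∃ k, A (σ k) (e k) = 0
      · obtain ⟨k, hk⟩ := hz
        rw [Finset.prod_eq_zero (Finset.mem_univ k), Finset.prod_eq_zero (Finset.mem_univ k)]
        · simpa using hk
        · simp [sharp, hk]
      · push Not at hz
        have hs : ∑ k, w (b (σ k)) = ∑ k, w (e k) := by
          rw [hw]; exact Equiv.sum_comp σ (fun k => w (b k))
        have := (Finset.sum_eq_sum_iff_of_le (fun k _ => key _ _ (hz k))).1 hs
        refine Finset.prod_congr rfl fun k _ => ?_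
        simp [sharp, this k (Finset.mem_univ k)]
    rw [this]
    simp [hw]
  · have : ((sharp A b w).submatrix id e).det = 0 := by
      rw [Matrix.det_apply]
      refine Finset.sum_eq_zero fun σ _ => ?_
      have hz : ∃ k, w (b (σ k)) ≠ w (e k) := by
        by_contra hz
        push Not at hz
        apply hw
        rw [← Equiv.sum_comp σ (fun k => w (b k))]
        exact Finset.sum_congr rfl fun k _ => (hz k).symm
      obtain ⟨k, hk⟩ := hz
      rw [Finset.prod_eq_zero (Finset.mem_univ k), smul_zero]
      simp [sharp, hk]
    simp [this, hw]
end

section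
/- Let (A1, A2) be an r×n matrix pair over a field K with column set E, let w : E → ℝ, and let B be a minimum-weight common base with A1[B] = A2[B] = I_r (row sets identified with B). Let w1, w2 : E → ℝ be split weights satisfying (W1) w1 + w2 = w and (W2) a common base B' minimizes w among common bases if and only if B' minimizes w1 among bases of A1 and w2 among bases of A2, and define A1#, A2# by zeroing every entry (u, j) of A_k with w_k(u) ≠ w_k(j). Assume additionally that det A1[B'] · det A2[B'] = 1 for every common base B' of (A1, A2) (i.e., the pivoted pair is Pfaffian with constant 1). Then det(A1# · (A2#)ᵀ) = (N : K), where N is the number of minimum-weight common bases of (A1, A2) with respect to w and (N : K) is its cast into K. -/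
open Matrix

/-- `S` is a base of `A`: it has the right cardinality and `A[S]` is nonsingular. -/
def IsBase {K : Type*} [CommRing K] {ι F : Type*} [Fintype ι] [LinearOrder ι]
    [Fintype F] [LinearOrder F] (A : Matrix ι F K) (S : Finset F) : Prop :=
  S.card = Fintype.card ι ∧ (colSubE A S).det ≠ 0

/-- `S` is a common base of the pair `(A1, A2)`. -/
def IsCommonBase {K : Type*} [CommRing K] {ι F : Type*} [Fintype ι] [LinearOrder ι]
    [Fintype F] [LinearOrder F] (A1 A2 : Matrix ι F K) (S : Finset F) : Prop :=
  IsBase A1 S ∧ IsBase A2 S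

/-- The set of minimum-weight common bases of `(A1, A2)` with respect to `w`. -/
noncomputable def minWeightCommonBases {K : Type*} [CommRing K] {ι F : Type*} [Fintype ι]
    [LinearOrder ι] [Fintype F] [LinearOrder F] (A1 A2 : Matrix ι F K) (w : F → ℝ) :
    Finset (Finset F) := by
  classical
  exact Finset.univ.filter (fun B' => IsCommonBase A1 A2 B' ∧
    ∀ S : Finset F, IsCommonBase A1 A2 S → ∑ j ∈ B', w j ≤ ∑ j ∈ S, w j)

theorem aux_exists_g {ι F : Type*} [Fintype ι] [LinearOrder ι]
    [Fintype F] [LinearOrder F] (S : Finset F) (h : S.card = Fintype.card ι) :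
    ∃ g : ι → F, Function.Injective g ∧ Finset.univ.image g = S ∧
      ∀ {K : Type _} [CommRing K] (A : Matrix ι F K), colSubE A S = A.submatrix id g := by
  have hinj : Function.Injective (fun i : ι =>
      S.orderEmbOfFin h ((Finset.univ.orderIsoOfFin Finset.card_univ).symm
        ⟨i, Finset.mem_univ i⟩)) := by
    intro i j hij
    have h1 := (S.orderEmbOfFin h).injective hij
    have h2 := (Finset.univ.orderIsoOfFin (Finset.card_univ (α := ι))).symm.injective h1
    simpa using h2
  refine ⟨_, hinj, ?_, ?_⟩
  · apply Finset.eq_of_subset_of_card_le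
    · intro x hx
      obtain ⟨i, -, rfl⟩ := Finset.mem_image.1 hx
      exact Finset.orderEmbOfFin_mem _ _ _
    · rw [Finset.card_image_of_injective _ hinj, h, Finset.card_univ]
  · intro K _ A
    simp only [colSubE, dif_pos h]

theorem aux_exists_perm {ι F : Type*} [Fintype ι] [DecidableEq ι] [DecidableEq F]
    (f g : ι → F) (hf : Function.Injective f)
    (h : Finset.univ.image f = Finset.univ.image g) :
    ∃ σ : Equiv.Perm ι, f = g ∘ σ := by
  have : ∀ i, ∃ k, g k = f i := by
    intro i
    have : f i ∈ Finset.univ.image g := h ▸ Finset.mem_image_of_mem f (Finset.mem_univ i)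
    simpa using this
  choose τ hτ using this
  have hinj : Function.Injective τ := by
    intro i j hij
    apply hf
    rw [← hτ i, ← hτ j, hij]
  exact ⟨Equiv.ofBijective τ (Finite.injective_iff_bijective.1 hinj), by
    funext i; simp [hτ]⟩

theorem aux_cauchy_binet {K : Type*} [CommRing K] {ι F : Type*} [Fintype ι] [LinearOrder ι]
    [Fintype F] [LinearOrder F] (M N : Matrix ι F K) :
    (M * Nᵀ).det = ∑ S ∈ Finset.univ.powersetCard (Fintype.card ι),
      (colSubE M S).det * (colSubE N S).det := by
  have h1 : (M * Nᵀ).det = ∑ f : ι → F, (∏ i, N i (f i)) * (M.submatrix id f).det := by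
    simp only [Matrix.det_apply', Matrix.mul_apply, Finset.prod_univ_sum, Finset.mul_sum,
      Fintype.piFinset_univ, Matrix.transpose_apply, Matrix.submatrix_apply, id]
    rw [Finset.sum_comm]
    refine Finset.sum_congr rfl fun f _ => Finset.sum_congr rfl fun σ _ => ?_
    rw [Finset.prod_mul_distrib]
    ring
  have h2 : ∑ f : ι → F, (∏ i, N i (f i)) * (M.submatrix id f).det =
      ∑ f : ι → F with Function.Injective f, (∏ i, N i (f i)) * (M.submatrix id f).det := by
    symm
    apply Finset.sum_subset (Finset.filter_subset _ _)
    intro f _ hf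
    have hf' : ¬ Function.Injective f := by simpa using hf
    unfold Function.Injective at hf'
    push Not at hf'
    obtain ⟨i, j, hij, hne⟩ := hf'
    rw [Matrix.det_zero_of_column_eq hne, mul_zero]
    intro k
    simp [hij]
  rw [h1, h2, ← Finset.sum_fiberwise_of_maps_to
    (t := Finset.univ.powersetCard (Fintype.card ι)) (g := fun f : ι → F => Finset.univ.image f)]
  · refine Finset.sum_congr rfl fun S hS => ?_
    have hc : S.card = Fintype.card ι := (Finset.mem_powersetCard.1 hS).2
    obtain ⟨g, hg, hgS, hcol⟩ := aux_exists_g (ι := ι) S hc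
    rw [hcol, hcol, ← Matrix.det_transpose (N.submatrix id g), Matrix.det_apply' (_)ᵀ,
      Finset.mul_sum]
    symm
    refine Finset.sum_nbij (fun σ : Equiv.Perm ι => g ∘ σ) ?_ ?_ ?_ ?_
    · intro σ _
      simp only [Finset.mem_filter, Finset.mem_univ, true_and]
      refine ⟨hg.comp σ.injective, ?_⟩
      rw [← hgS, ← Finset.image_image, Finset.image_univ_equiv]
    · intro σ _ τ _ h
      ext i
      exact hg (congrFun h i)
    · intro f hf
      simp only [Finset.coe_filter, Finset.mem_filter, Finset.mem_univ, true_and,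
        Set.mem_ofPred_eq] at hf
      obtain ⟨σ, hσ⟩ := aux_exists_perm f g hf.1 (hf.2.trans hgS.symm)
      exact ⟨σ, by simp, hσ.symm⟩
    · intro σ _
      have : M.submatrix id (g ∘ σ) = (M.submatrix id g).submatrix id σ := rfl
      rw [this, Matrix.det_permute']
      simp only [Matrix.transpose_apply, Matrix.submatrix_apply, id, Function.comp]
      ring
  · intro f hf
    have hf : Function.Injective f := by simpa using hf
    rw [Finset.mem_powersetCard]
    exact ⟨Finset.subset_univ _, by rw [Finset.card_image_of_injective _ hf, Finset.card_univ]⟩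

theorem aux_isBase_image {K : Type*} [CommRing K] {ι F : Type*} [Fintype ι]
    [LinearOrder ι] [Fintype F] [LinearOrder F] (A : Matrix ι F K) (f : ι → F)
    (hf : Function.Injective f) (hd : (A.submatrix id f).det ≠ 0) :
    IsBase A (Finset.univ.image f) := by
  have hc : (Finset.univ.image f).card = Fintype.card ι := by
    rw [Finset.card_image_of_injective _ hf, Finset.card_univ]
  refine ⟨hc, ?_⟩
  obtain ⟨g, hg, hgS, hcol⟩ := aux_exists_g (ι := ι) _ hc
  obtain ⟨σ, hσ⟩ := aux_exists_perm f g hf hgS.symm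
  rw [hcol]
  intro h0
  apply hd
  have : A.submatrix id f = (A.submatrix id g).submatrix id σ := by rw [hσ]; rfl
  rw [this, Matrix.det_permute', h0, mul_zero]

theorem aux_weight {K : Type*} [Field K] {ι E : Type*} [Fintype ι]
    [LinearOrder ι] [Fintype E] [LinearOrder E]
    (A : Matrix ι E K) (b : ι → E) (hb : Function.Injective b)
    (hA : ∀ i i' : ι, A i (b i') = if i = i' then 1 else 0) (w : E → ℝ)
    (hmin : ∀ S : Finset E, IsBase A S → ∑ j ∈ Finset.univ.image b, w j ≤ ∑ j ∈ S, w j)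
    (i : ι) (j : E) (hij : A i j ≠ 0) : w (b i) ≤ w j := by
  by_cases hj : ∃ k, b k = j
  · obtain ⟨k, rfl⟩ := hj
    rw [hA] at hij
    have : i = k := by by_contra h; simp [h] at hij
    rw [this]
  · push Not at hj
    have hf : Function.Injective (Function.update b i j) := by
      intro x y hxy
      by_cases hx : x = i <;> by_cases hy : y = i
      · rw [hx, hy]
      · subst hx; simp [hy] at hxy; exact absurd hxy.symm (hj y)
      · subst hy; simp [hx] at hxy; exact absurd hxy (hj x)
      · simp [hx, hy] at hxy; exact hb hxy
    have hS : A.submatrix id (Function.update b i j)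
        = (1 : Matrix ι ι K).updateCol i (fun k => A k j) := by
      ext k l
      by_cases hl : l = i
      · subst hl; simp
      · simp [hl, hA, Matrix.one_apply]
    have hd : (A.submatrix id (Function.update b i j)).det ≠ 0 := by
      rw [hS, ← Matrix.cramer_apply, Matrix.cramer_one]
      simpa using hij
    have h := hmin _ (aux_isBase_image A _ hf hd)
    rw [Finset.sum_image hb.injOn, Finset.sum_image hf.injOn] at h
    rw [← Finset.add_sum_erase _ _ (Finset.mem_univ i),
      ← Finset.add_sum_erase (a := i) _ (fun x => w (Function.update b i j x)) (Finset.mem_univ i)]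
      at h
    have he : ∑ x ∈ Finset.univ.erase i, w (Function.update b i j x)
        = ∑ x ∈ Finset.univ.erase i, w (b x) := by
      refine Finset.sum_congr rfl fun x hx => ?_
      simp [Finset.ne_of_mem_erase hx]
    rw [he] at h
    rw [Function.update_self] at h
    linarith

theorem aux_det_sharp {K : Type*} [Field K] {ι E : Type*} [Fintype ι]
    [LinearOrder ι] [Fintype E] [LinearOrder E]
    (A : Matrix ι E K) (b : ι → E) (hb : Function.Injective b)
    (hA : ∀ i i' : ι, A i (b i') = if i = i' then 1 else 0) (w : E → ℝ)
    (hmin : ∀ S : Finset E, IsBase A S → ∑ j ∈ Finset.univ.image b, w j ≤ ∑ j ∈ S, w j)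
    (S : Finset E) (hS : S.card = Fintype.card ι) :
    (colSubE (sharp A b w) S).det =
      if ∑ j ∈ S, w j = ∑ j ∈ Finset.univ.image b, w j then (colSubE A S).det else 0 := by
  obtain ⟨g, hg, hgS, hcol⟩ := aux_exists_g (ι := ι) S hS
  rw [hcol, hcol, ← hgS, Finset.sum_image hb.injOn, Finset.sum_image hg.injOn]
  have hperm : ∀ σ : Equiv.Perm ι, ∑ i, w (b (σ i)) = ∑ i, w (b i) := fun σ =>
    Equiv.sum_comp σ (fun i => w (b i))
  have key : ∀ σ : Equiv.Perm ι, ∏ i, (sharp A b w) (σ i) (g i) =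
      if ∑ i, w (g i) = ∑ i, w (b i) then ∏ i, A (σ i) (g i) else 0 := by
    intro σ
    by_cases hall : ∀ i, w (b (σ i)) = w (g i)
    · rw [if_pos]
      · simp [sharp, hall]
      · rw [← hperm σ]; exact Finset.sum_congr rfl fun i _ => (hall i).symm
    · have hz : ∏ i, (sharp A b w) (σ i) (g i) = 0 := by
        push Not at hall
        obtain ⟨i, hi⟩ := hall
        exact Finset.prod_eq_zero (Finset.mem_univ i) (by simp [sharp, hi])
      rw [hz]
      split_ifs with hs
      · by_contra hne
        apply hall
        have hnz : ∀ i, A (σ i) (g i) ≠ 0 := fun i h0 =>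
          hne (Finset.prod_eq_zero (Finset.mem_univ i) h0).symm
        have hle : ∀ i ∈ Finset.univ, w (b (σ i)) ≤ w (g i) := fun i _ =>
          aux_weight A b hb hA w hmin _ _ (hnz i)
        have := (Finset.sum_eq_sum_iff_of_le hle).1 ((hperm σ).trans hs.symm)
        exact fun i => this i (Finset.mem_univ i)
      · rfl
  simp only [Matrix.det_apply', Matrix.submatrix_apply, id, key]
  split_ifs <;> simp

/-- Counting minimum-weight common bases of a Pfaffian pair: under the setting of the weight
splitting lemma, if moreover `det A1[B'] * det A2[B'] = 1` for every common base `B'`, then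
`det (A1# * (A2#)ᵀ)` equals the number of minimum-weight common bases of `(A1, A2)`, cast
into `K`. -/
theorem count_min_weight_common_bases {K : Type*} [Field K] {ι E : Type*} [Fintype ι]
    [LinearOrder ι] [Fintype E] [LinearOrder E]
    (A1 A2 : Matrix ι E K) (b : ι → E) (hb : Function.Injective b)
    (hA1 : ∀ i i' : ι, A1 i (b i') = if i = i' then 1 else 0)
    (hA2 : ∀ i i' : ι, A2 i (b i') = if i = i' then 1 else 0)
    (w w1 w2 : E → ℝ)
    (hBcb : IsCommonBase A1 A2 (Finset.univ.image b))
    (hBmin : ∀ S : Finset E, IsCommonBase A1 A2 S →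
      ∑ j ∈ Finset.univ.image b, w j ≤ ∑ j ∈ S, w j)
    (hW1 : ∀ j, w1 j + w2 j = w j)
    (hW2 : ∀ B' : Finset E, IsCommonBase A1 A2 B' →
      ((∀ S : Finset E, IsCommonBase A1 A2 S → ∑ j ∈ B', w j ≤ ∑ j ∈ S, w j) ↔
        ((∀ S : Finset E, IsBase A1 S → ∑ j ∈ B', w1 j ≤ ∑ j ∈ S, w1 j) ∧
         (∀ S : Finset E, IsBase A2 S → ∑ j ∈ B', w2 j ≤ ∑ j ∈ S, w2 j))))
    (hPf : ∀ B' : Finset E, IsCommonBase A1 A2 B' →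
      (colSubE A1 B').det * (colSubE A2 B').det = 1) :
    (sharp A1 b w1 * (sharp A2 b w2)ᵀ).det
      = ((minWeightCommonBases A1 A2 w).card : K) := by
  classical
  obtain ⟨hm1, hm2⟩ := (hW2 _ hBcb).1 hBmin
  have hw : ∀ S : Finset E, ∑ j ∈ S, w j = ∑ j ∈ S, w1 j + ∑ j ∈ S, w2 j := fun S => by
    rw [← Finset.sum_add_distrib]
    exact Finset.sum_congr rfl fun j _ => (hW1 j).symm
  have hiff : ∀ S, IsCommonBase A1 A2 S →
      ((∀ T : Finset E, IsCommonBase A1 A2 T → ∑ j ∈ S, w j ≤ ∑ j ∈ T, w j) ↔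
        (∑ j ∈ S, w1 j = ∑ j ∈ Finset.univ.image b, w1 j ∧
          ∑ j ∈ S, w2 j = ∑ j ∈ Finset.univ.image b, w2 j)) := by
    intro S hS
    constructor
    · intro h
      obtain ⟨h1, h2⟩ := (hW2 S hS).1 h
      exact ⟨le_antisymm (h1 _ hBcb.1) (hm1 _ hS.1), le_antisymm (h2 _ hBcb.2) (hm2 _ hS.2)⟩
    · rintro ⟨h1, h2⟩ T hT
      have := hBmin T hT
      rw [hw S, h1, h2, ← hw]
      exact this
  rw [aux_cauchy_binet]
  have hterm : ∀ S ∈ (Finset.univ : Finset E).powersetCard (Fintype.card ι),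
      (colSubE (sharp A1 b w1) S).det * (colSubE (sharp A2 b w2) S).det
        = if S ∈ minWeightCommonBases A1 A2 w then (1 : K) else 0 := by
    intro S hS
    have hc : S.card = Fintype.card ι := (Finset.mem_powersetCard.1 hS).2
    rw [aux_det_sharp A1 b hb hA1 w1 hm1 S hc, aux_det_sharp A2 b hb hA2 w2 hm2 S hc]
    have hmem : S ∈ minWeightCommonBases A1 A2 w ↔ IsCommonBase A1 A2 S ∧
        ∀ T : Finset E, IsCommonBase A1 A2 T → ∑ j ∈ S, w j ≤ ∑ j ∈ T, w j := by
      simp [minWeightCommonBases]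
    by_cases hcb : IsCommonBase A1 A2 S
    · by_cases h : ∑ j ∈ S, w1 j = ∑ j ∈ Finset.univ.image b, w1 j ∧
          ∑ j ∈ S, w2 j = ∑ j ∈ Finset.univ.image b, w2 j
      · rw [if_pos h.1, if_pos h.2, if_pos (hmem.2 ⟨hcb, (hiff S hcb).2 h⟩), hPf S hcb]
      · rw [if_neg (fun hh => h ((hiff S hcb).1 (hmem.1 hh).2))]
        by_cases h1 : ∑ j ∈ S, w1 j = ∑ j ∈ Finset.univ.image b, w1 j
        · rw [if_neg (fun h2 => h ⟨h1, h2⟩), mul_zero]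
        · rw [if_neg h1, zero_mul]
    · rw [if_neg (fun hh => hcb (hmem.1 hh).1)]
      by_cases d1 : (colSubE A1 S).det = 0
      · simp [d1]
      · have d2 : (colSubE A2 S).det = 0 := by
          by_contra d2
          exact hcb ⟨⟨hc, d1⟩, ⟨hc, d2⟩⟩
        simp [d2]
  rw [Finset.sum_congr rfl hterm, ← Finset.sum_filter, Finset.sum_const, nsmul_eq_mul, mul_one]
  congr 2
  ext S
  simp only [Finset.mem_filter, Finset.mem_powersetCard, Finset.subset_univ, true_and,
    and_iff_right_iff_imp]
  intro h
  have : IsCommonBase A1 A2 S := by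
    simp only [minWeightCommonBases, Finset.mem_filter] at h
    exact h.2.1
  exact this.1.1
end
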